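/- Let d be a sufficiently large integer and let G = (V, E) be a finite graph with |E|/|V| ≥ d. Then G contains a minor of the complete graph on at least d/(10·√(ln d)) vertices, i.e., the complete graph K_t with t = ⌈d/(10·√(ln d))⌉ is a minor of G. -/

import Mathlib

/-- `G` has a complete minor of order `t`: there are `t` pairwise disjoint nonempty
branch sets, each inducing a connected subgraph of `G`, with an edge of `G` between
every two of them. -/
def SimpleGraph.HasCompleteMinor {V : Type*} (G : SimpleGraph V) (t : ℕ) : Prop :=
  ∃ B : Fin t → Set V,
    (∀ i, (B i).Nonempty) ∧
    (∀ i j, i ≠ j → Disjoint (B i) (B j)) ∧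
    (∀ i, (G.induce (B i)).Connected) ∧
    (∀ i j, i ≠ j → ∃ u ∈ B i, ∃ v ∈ B j, G.Adj u v)

namespace KT

theorem conn_of_cut {V : Type} (G : SimpleGraph V) (S : Set V) (hne : S.Nonempty)
    (h : ∀ X : Set V, X ⊆ S → X.Nonempty → (S \ X).Nonempty → ∃ a ∈ X, ∃ b ∈ S \ X, G.Adj a b) :
    (G.induce S).Connected := by
  have : Nonempty S := hne.to_subtype
  refine SimpleGraph.Connected.mk ?_
  rintro ⟨x, hx⟩ ⟨y, hy⟩
  by_contra hxy
  obtain ⟨a, ⟨ha, har⟩, b, ⟨hb, hbn⟩, hab⟩ :=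
    h {z | ∃ hz : z ∈ S, (G.induce S).Reachable ⟨x, hx⟩ ⟨z, hz⟩} (fun z hz => hz.1)
      ⟨x, hx, SimpleGraph.Reachable.refl _⟩ ⟨y, hy, fun hc => hxy hc.2⟩
  refine hbn ⟨hb, har.trans (SimpleGraph.Adj.reachable ?_)⟩
  simpa using hab

theorem cut_of_conn {V : Type} (G : SimpleGraph V) (S : Set V) (hc : (G.induce S).Connected)
    (X : Set V) (hX : X ⊆ S) (h1 : X.Nonempty) (h2 : (S \ X).Nonempty) :
    ∃ a ∈ X, ∃ b ∈ S \ X, G.Adj a b := by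
  obtain ⟨x, hx⟩ := h1
  obtain ⟨y, hy, hyX⟩ := h2
  obtain ⟨p⟩ := hc.preconnected ⟨x, hX hx⟩ ⟨y, hy⟩
  obtain ⟨e, -, h1, h2⟩ := p.exists_boundary_dart {z | z.1 ∈ X} hx hyX
  exact ⟨e.fst.1, h1, e.snd.1, ⟨e.snd.2, h2⟩, by simpa using e.adj⟩

theorem conn_insert {V : Type} (G : SimpleGraph V) (K : Set V) (hc : (G.induce K).Connected)
    (x y : V) (hx : x ∈ K) (h : G.Adj x y) : (G.induce (insert y K)).Connected := by
  refine conn_of_cut _ _ ⟨y, by simp⟩ ?_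
  rintro X hX h1 ⟨z, hz, hzX⟩
  by_cases hy : y ∈ X
  · by_cases hx' : x ∈ X
    · have hzK : z ∈ K := by
        rcases hz with rfl | hz
        · exact absurd hy hzX
        · exact hz
      obtain ⟨a, ha, b, hb, hab⟩ := cut_of_conn G K hc (X ∩ K) (by simp) ⟨x, hx', hx⟩
        ⟨z, hzK, fun h => hzX h.1⟩
      exact ⟨a, ha.1, b, ⟨Or.inr hb.1, fun h => hb.2 ⟨h, hb.1⟩⟩, hab⟩
    · exact ⟨y, hy, x, ⟨Or.inr hx, hx'⟩, h.symm⟩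
  · by_cases hx' : x ∈ X
    · exact ⟨x, hx', y, ⟨Or.inl rfl, hy⟩, h⟩
    · have hXK : X ⊆ K := by
        intro w hw
        rcases hX hw with rfl | h
        · exact absurd hw hy
        · exact h
      obtain ⟨a, ha, b, hb, hab⟩ := cut_of_conn G K hc X hXK h1
        ⟨x, hx, hx'⟩
      exact ⟨a, ha, b, ⟨Or.inr hb.1, hb.2⟩, hab⟩

theorem lift {V V' : Type} (G : SimpleGraph V) (G' : SimpleGraph V') (F : V' → Set V)
    (hd : ∀ a b, a ≠ b → Disjoint (F a) (F b)) (hc : ∀ a, (G.induce (F a)).Connected)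
    (ha : ∀ a b, G'.Adj a b → ∃ x ∈ F a, ∃ y ∈ F b, G.Adj x y) (t : ℕ)
    (h : G'.HasCompleteMinor t) : G.HasCompleteMinor t := by
  have hne : ∀ a, (F a).Nonempty := fun a => by
    obtain ⟨x, hx⟩ := (hc a).nonempty
    exact ⟨x, hx⟩
  obtain ⟨B, h1, h2, h3, h4⟩ := h
  have hne' : ∀ i, (⋃ a ∈ B i, F a).Nonempty := fun i => by
    obtain ⟨a, hai⟩ := h1 i
    obtain ⟨x, hx⟩ := hne a
    exact ⟨x, by simp only [Set.mem_iUnion]; exact ⟨a, hai, hx⟩⟩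
  refine ⟨fun i => ⋃ a ∈ B i, F a, hne', ?_, ?_, ?_⟩
  · intro i j hij
    rw [Set.disjoint_left]
    simp only [Set.mem_iUnion, not_exists]
    rintro x ⟨a, hai, hx⟩ b hb hx'
    have hab : a ≠ b := by
      rintro rfl
      exact Set.disjoint_left.1 (h2 i j hij) hai hb
    exact Set.disjoint_left.1 (hd a b hab) hx hx'
  · intro i
    refine conn_of_cut _ _ (hne' i) ?_
    rintro X hX ⟨x, hx⟩ ⟨y, hy, hyX⟩
    by_cases hsat : ∃ a ∈ B i, (F a ∩ X).Nonempty ∧ (F a \ X).Nonempty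
    · obtain ⟨a, hai, ⟨p, hp⟩, ⟨q, hq⟩⟩ := hsat
      obtain ⟨r, hr, s, hs, hrs⟩ := cut_of_conn G (F a) (hc a) (F a ∩ X) (by simp) ⟨p, hp⟩
        ⟨q, hq.1, fun h => hq.2 h.2⟩
      refine ⟨r, hr.2, s, ⟨?_, fun h => hs.2 ⟨hs.1, h⟩⟩, hrs⟩
      simp only [Set.mem_iUnion]; exact ⟨a, hai, hs.1⟩
    · push Not at hsat
      have hx2 := hX hx
      simp only [Set.mem_iUnion] at hx2 hy
      obtain ⟨a, hai, hxa⟩ := hx2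
      obtain ⟨b, hbi, hyb⟩ := hy
      obtain ⟨r, hr, s, hs, hrs⟩ := cut_of_conn G' (B i) (h3 i) {c ∈ B i | F c ⊆ X} (by simp)
        ⟨a, hai, by
          have := hsat a hai ⟨x, hxa, hx⟩
          exact Set.sdiff_eq_empty.1 this⟩
        ⟨b, hbi, fun hh => hyX (hh.2 hyb)⟩
      obtain ⟨p, hp, q, hq, hpq⟩ := ha r s hrs
      refine ⟨p, hr.2 hp, q, ⟨?_, fun hqX => hs.2 ⟨hs.1, ?_⟩⟩, hpq⟩
      · simp only [Set.mem_iUnion]; exact ⟨s, hs.1, hq⟩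
      · exact Set.sdiff_eq_empty.1 (hsat s hs.1 ⟨q, hq, hqX⟩)
  · intro i j hij
    obtain ⟨a, hai, b, hbj, hab⟩ := h4 i j hij
    obtain ⟨x, hx, y, hy, hxy⟩ := ha a b hab
    simp only [Set.mem_iUnion]
    exact ⟨x, ⟨a, hai, hx⟩, y, ⟨b, hbj, hy⟩, hxy⟩

theorem conn_singleton {V : Type} (G : SimpleGraph V) (x : V) :
    (G.induce ({x} : Set V)).Connected := by
  refine conn_of_cut _ _ ⟨x, rfl⟩ ?_
  rintro X hX ⟨y, hy⟩ ⟨z, hz, hzX⟩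
  have h1 : y = x := hX hy
  have h2 : z = x := hz
  subst h1; subst h2
  exact absurd hy hzX

theorem lift_emb {V V' : Type} (G : SimpleGraph V) (G' : SimpleGraph V') (f : V' → V)
    (hf : Function.Injective f) (ha : ∀ a b, G'.Adj a b → G.Adj (f a) (f b)) (t : ℕ)
    (h : G'.HasCompleteMinor t) : G.HasCompleteMinor t := by
  refine lift G G' (fun a => {f a}) ?_ (fun a => conn_singleton G _) ?_ t h
  · intro a b hab
    simpa using fun h => hab (hf h)
  · intro a b hab
    exact ⟨f a, rfl, f b, rfl, ha a b hab⟩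

end KT

namespace KT

open Classical in
theorem triple {V : Type} [Fintype V] (G : SimpleGraph V) (n δ u : ℕ)
    (hn : Fintype.card V = n) (hδ : ∀ v, δ ≤ (Finset.univ.filter (G.Adj v)).card)
    (h3 : 2 * u + n < 3 * δ) (U : Finset V) (hU : U.card ≤ u) (x y z : V) :
    (∃ c, c ∉ U ∧ G.Adj x c ∧ G.Adj c y) ∨ (∃ c, c ∉ U ∧ G.Adj x c ∧ G.Adj c z) ∨
    (∃ c, c ∉ U ∧ G.Adj y c ∧ G.Adj c z) := by
  by_contra hcon
  push Not at hcon
  obtain ⟨h1, h2, h4⟩ := hcon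
  have key : ∀ v, δ ≤ (Finset.univ.filter (G.Adj v) \ U).card + U.card := fun v => by
    have := Finset.card_le_card_sdiff_add_card (s := Finset.univ.filter (G.Adj v)) (t := U)
    exact (hδ v).trans this
  have kx := key x
  have ky := key y
  have kz := key z
  have d1 : Disjoint (Finset.univ.filter (G.Adj x) \ U) (Finset.univ.filter (G.Adj y) \ U) := by
    rw [Finset.disjoint_left]
    intro c hc hc'
    simp only [Finset.mem_sdiff, Finset.mem_filter, Finset.mem_univ, true_and] at hc hc'
    exact h1 c hc.2 hc.1 hc'.1.symm
  have d2 : Disjoint (Finset.univ.filter (G.Adj x) \ U ∪ Finset.univ.filter (G.Adj y) \ U)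
      (Finset.univ.filter (G.Adj z) \ U) := by
    rw [Finset.disjoint_left]
    intro c hc hc'
    simp only [Finset.mem_union, Finset.mem_sdiff, Finset.mem_filter, Finset.mem_univ, true_and] at hc hc'
    rcases hc with hc | hc
    · exact h2 c hc.2 hc.1 hc'.1.symm
    · exact h4 c hc.2 hc.1 hc'.1.symm
  have d3 : Disjoint (Finset.univ.filter (G.Adj x) \ U ∪ Finset.univ.filter (G.Adj y) \ U ∪
      Finset.univ.filter (G.Adj z) \ U) U := by
    rw [Finset.disjoint_left]
    intro c hc hc'
    simp only [Finset.mem_union, Finset.mem_sdiff] at hc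
    tauto
  have := Finset.card_le_univ ((Finset.univ.filter (G.Adj x) \ U ∪ Finset.univ.filter (G.Adj y) \ U ∪
      Finset.univ.filter (G.Adj z) \ U) ∪ U)
  rw [Finset.card_union_of_disjoint d3, Finset.card_union_of_disjoint d2,
    Finset.card_union_of_disjoint d1] at this
  omega

open Classical in
theorem connect {V : Type} [Fintype V] (G : SimpleGraph V) (n δ u k : ℕ)
    (hn : Fintype.card V = n) (hδ : ∀ v, δ ≤ (Finset.univ.filter (G.Adj v)).card)
    (h3 : 2 * u + n < 3 * δ) (U : Finset V) (hU : U.card ≤ u)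
    (hconn : (G.induce {v | v ∉ U}).Connected) (B : Finset V) (hB : B.Nonempty)
    (hBk : B.card ≤ k) (hBU : ∀ b ∈ B, b ∉ U) :
    ∃ B' : Finset V, B ⊆ B' ∧ (∀ b ∈ B', b ∉ U) ∧ B'.card ≤ 2 * k + 6 ∧
      (G.induce (B' : Set V)).Connected := by
  have tr := triple G n δ u hn hδ h3 U hU
  obtain ⟨x, hx⟩ := hB
  have core : ∃ K : Finset V, x ∈ K ∧ K.card ≤ 6 ∧ (∀ b ∈ K, b ∉ U) ∧
      (G.induce (K : Set V)).Connected ∧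
      ∀ b, ∃ c r, b ∉ U → c ∉ U ∧ r ∈ K ∧ G.Adj r c ∧ G.Adj c b := by
    have hxx : ∃ c, c ∉ U ∧ G.Adj x c ∧ G.Adj c x := by
      rcases tr x x x with h | h | h <;> exact h
    by_cases hall : ∀ b, b ∉ U → ∃ c, c ∉ U ∧ G.Adj x c ∧ G.Adj c b
    · refine ⟨{x}, by simp, by simp, ?_, ?_, ?_⟩
      · intro b hb
        rw [Finset.mem_singleton] at hb
        subst hb; exact hBU _ hx
      · rw [Finset.coe_singleton]; exact conn_singleton G x
      · intro b
        by_cases hb : b ∈ U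
        · exact ⟨x, x, fun h => absurd hb h⟩
        · obtain ⟨c, h1, h2⟩ := hall b hb
          exact ⟨c, x, fun _ => ⟨h1, by simp, h2⟩⟩
    · push Not at hall
      obtain ⟨y, hyU, hy⟩ := hall
      have hxy : ¬ ∃ c, c ∉ U ∧ G.Adj x c ∧ G.Adj c y := by
        rintro ⟨c, h1, h2, h4⟩; exact hy c h1 h2 h4
      obtain ⟨z, ⟨hz, c, hc, hxc, hcz⟩, z', ⟨hz', hz'X⟩, hzz⟩ := cut_of_conn G _ hconn
        {z | z ∉ U ∧ ∃ c, c ∉ U ∧ G.Adj x c ∧ G.Adj c z} (fun z hz => hz.1)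
        ⟨x, hBU x hx, hxx⟩ ⟨y, hyU, fun h => hxy h.2⟩
      have hyz : ∃ c, c ∉ U ∧ G.Adj y c ∧ G.Adj c z' := by
        rcases tr x y z' with h | h | h
        · exact absurd h hxy
        · exact absurd ⟨hz', h⟩ hz'X
        · exact h
      obtain ⟨c', hc', hyc', hcz'⟩ := hyz
      refine ⟨{y, c', z', z, c, x}, by simp, Finset.card_le_six, ?_, ?_, ?_⟩
      · intro b hb
        simp only [Finset.mem_insert, Finset.mem_singleton] at hb
        rcases hb with rfl | rfl | rfl | rfl | rfl | rfl
        · exact hyU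
        · exact hc'
        · exact hz'
        · exact hz
        · exact hc
        · exact hBU _ hx
      · have e1 := conn_insert G {x} (conn_singleton G x) x c (by simp) hxc
        have e2 := conn_insert G _ e1 c z (by simp) hcz
        have e3 := conn_insert G _ e2 z z' (by simp) hzz
        have e4 := conn_insert G _ e3 z' c' (by simp) hcz'.symm
        have e5 := conn_insert G _ e4 c' y (by simp) hyc'.symm
        have e6 : (({y, c', z', z, c, x} : Finset V) : Set V) = {y, c', z', z, c, x} := by
          push_cast; rfl
        rw [e6]; exact e5
      · intro b
        rcases tr x y b with h | ⟨c, h1, h2⟩ | ⟨c, h1, h2⟩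
        · exact absurd h hxy
        · exact ⟨c, x, fun _ => ⟨h1, by simp, h2⟩⟩
        · exact ⟨c, y, fun _ => ⟨h1, by simp, h2⟩⟩
  obtain ⟨K, hxK, hK6, hKU, hKc, hK⟩ := core
  choose c r hcr using hK
  refine ⟨B ∪ B.image c ∪ K, ?_, ?_, ?_, ?_⟩
  · intro b hb; simp [hb]
  · intro b hb
    simp only [Finset.mem_union, Finset.mem_image] at hb
    rcases hb with (hb | ⟨a, ha, rfl⟩) | hb
    · exact hBU b hb
    · exact (hcr a (hBU a ha)).1
    · exact hKU b hb
  · have h1 := Finset.card_union_le (B ∪ B.image c) K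
    have h2 := Finset.card_union_le B (B.image c)
    have h4 : (B.image c).card ≤ B.card := Finset.card_image_le
    omega
  · have patch : ∀ b ∈ B, (G.induce (insert b (insert (c b) (K : Set V)))).Connected := by
      intro b hb
      obtain ⟨-, q1, q2, q3⟩ := hcr b (hBU b hb)
      exact conn_insert G _ (conn_insert G _ hKc (r b) (c b) q1 q2) (c b) b (by simp) q3
    refine SimpleGraph.induce_connected_of_patches x (by simp [hx]) ?_
    intro v hv
    simp only [Finset.coe_union, Finset.coe_image, Set.mem_union, Finset.mem_coe, Set.mem_image] at hv
    have sub : ∀ b ∈ B, insert b (insert (c b) (K : Set V)) ⊆ ((B ∪ B.image c ∪ K : Finset V) : Set V) := by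
      intro b hb w hw
      simp only [Set.mem_insert_iff, Finset.mem_coe] at hw
      simp only [Finset.coe_union, Finset.coe_image, Set.mem_union, Finset.mem_coe, Set.mem_image]
      rcases hw with rfl | rfl | hw
      · exact Or.inl (Or.inl hb)
      · exact Or.inl (Or.inr ⟨b, hb, rfl⟩)
      · exact Or.inr hw
    rcases hv with (hb | ⟨a, ha, rfl⟩) | hb
    · exact ⟨_, sub v hb, by simp [hxK], by simp, (patch v hb).preconnected _ _⟩
    · exact ⟨_, sub a ha, by simp [hxK], by simp, (patch a ha).preconnected _ _⟩
    · exact ⟨_, sub x hx, by simp [hxK], by simp [hb], (patch x hx).preconnected _ _⟩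

end KT

namespace KT

open Classical in
theorem prob {V : Type} [Fintype V] (G : SimpleGraph V) (W : Finset V) (k a q t m : ℕ)
    (hm : W.card = m)
    (hq : ∀ v, (W.filter (fun w => ¬ G.Adj v w)).card ≤ q)
    (h1 : 2 * (m * q ^ k) ≤ (a + 1) * m ^ k) (h2 : 2 * (t * a ^ k) < m ^ k)
    (i : ℕ) (hi : i ≤ t) (A : ℕ → Finset V) (hA : ∀ j < i, (A j).card ≤ a) :
    ∃ f : Fin k → V, (∀ l, f l ∈ W) ∧ (W.filter (fun v => ∀ l, ¬ G.Adj v (f l))).card ≤ a ∧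
      ∀ j < i, ∃ l, f l ∉ A j := by
  by_contra hcon
  push Not at hcon
  let Ω : Finset (Fin k → V) := Fintype.piFinset (fun _ => W)
  have hΩ : Ω.card = m ^ k := by simp [Ω, hm]
  let bad1 : Finset (Fin k → V) := Ω.filter (fun f => a + 1 ≤ (W.filter (fun v => ∀ l, ¬ G.Adj v (f l))).card)
  let bad2 : Finset (Fin k → V) := (Finset.range i).biUnion (fun j => Fintype.piFinset (fun _ => A j))
  have hcov : Ω ⊆ bad1 ∪ bad2 := by
    intro f hf
    have hf' : ∀ l, f l ∈ W := by simpa [Ω] using hf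
    rw [Finset.mem_union]
    by_cases hb : (W.filter (fun v => ∀ l, ¬ G.Adj v (f l))).card ≤ a
    · right
      obtain ⟨j, hj, hl⟩ := hcon f hf' hb
      simp only [bad2, Finset.mem_biUnion, Finset.mem_range, Fintype.mem_piFinset]
      exact ⟨j, hj, hl⟩
    · left
      simp only [bad1, Finset.mem_filter]
      exact ⟨hf, by omega⟩
  have hb2 : bad2.card ≤ t * a ^ k := by
    calc bad2.card ≤ ∑ j ∈ Finset.range i, (Fintype.piFinset (fun _ : Fin k => A j)).card :=
          Finset.card_biUnion_le
      _ ≤ ∑ j ∈ Finset.range i, a ^ k := by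
          apply Finset.sum_le_sum
          intro j hj
          simp only [Fintype.card_piFinset_const]
          exact Nat.pow_le_pow_left (hA j (Finset.mem_range.1 hj)) k
      _ = i * a ^ k := by simp
      _ ≤ t * a ^ k := Nat.mul_le_mul_right _ hi
  have hb1 : (a + 1) * bad1.card ≤ m * q ^ k := by
    calc (a + 1) * bad1.card = ∑ f ∈ bad1, (a + 1) := by simp [mul_comm]
      _ ≤ ∑ f ∈ bad1, (W.filter (fun v => ∀ l, ¬ G.Adj v (f l))).card := by
          apply Finset.sum_le_sum
          intro f hf
          exact (Finset.mem_filter.1 hf).2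
      _ ≤ ∑ f ∈ Ω, (W.filter (fun v => ∀ l, ¬ G.Adj v (f l))).card :=
          Finset.sum_le_sum_of_subset (Finset.filter_subset _ _)
      _ = ∑ v ∈ W, (Ω.filter (fun f => ∀ l, ¬ G.Adj v (f l))).card := by
          simp only [Finset.card_filter]
          exact Finset.sum_comm
      _ ≤ ∑ v ∈ W, q ^ k := by
          apply Finset.sum_le_sum
          intro v _
          have : Ω.filter (fun f => ∀ l, ¬ G.Adj v (f l)) =
              Fintype.piFinset (fun _ : Fin k => W.filter (fun w => ¬ G.Adj v w)) := by
            ext f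
            simp [Ω, forall_and]
          rw [this, Fintype.card_piFinset_const]
          exact Nat.pow_le_pow_left (hq v) k
      _ = m * q ^ k := by simp [hm]
  have hc := Finset.card_le_card hcov
  have hc2 := Finset.card_union_le bad1 bad2
  rw [hΩ] at hc
  have h5 : m ^ k < 2 * bad1.card := by omega
  have h6 : (a + 1) * m ^ k < (a + 1) * (2 * bad1.card) := Nat.mul_lt_mul_of_pos_left h5 (by omega)
  nlinarith

end KT

namespace KT

open Classical in
theorem greedy {V : Type} [Fintype V] (G : SimpleGraph V) (n δ u k t a : ℕ)
    (hn : Fintype.card V = n) (hδ : ∀ v, δ ≤ (Finset.univ.filter (G.Adj v)).card)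
    (h3 : 2 * u + n < 3 * δ)
    (hconn : ∀ U : Finset V, U.card ≤ u → (G.induce {v | v ∉ U}).Connected)
    (hk : 1 ≤ k) (htu : t * (2 * k + 6) ≤ u)
    (h1 : ∀ m, n ≤ m + u → m ≤ n → 2 * (m * (n - δ) ^ k) ≤ (a + 1) * m ^ k)
    (h2 : ∀ m, n ≤ m + u → 2 * (t * a ^ k) < m ^ k) (i : ℕ) (hi : i ≤ t) :
    ∃ B A : ℕ → Finset V, (∀ j < i, (B j).Nonempty ∧ (B j).card ≤ 2 * k + 6 ∧
        (G.induce (B j : Set V)).Connected ∧ (A j).card ≤ a) ∧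
      (∀ j < i, ∀ j' < j, Disjoint (B j') (B j) ∧ ∃ x ∈ B j', ∃ y ∈ B j, G.Adj x y) ∧
      (∀ v, (∀ j < i, v ∉ B j) → ∀ j < i, v ∉ A j → ∃ x ∈ B j, G.Adj x v) := by
  induction i with
  | zero => exact ⟨fun _ => ∅, fun _ => ∅, by simp, by simp, by simp⟩
  | succ i ih =>
    obtain ⟨B, A, hB, hBB, hdom⟩ := ih (by omega)
    let U := (Finset.range i).biUnion B
    have hUc : U.card ≤ u := by
      calc U.card ≤ ∑ j ∈ Finset.range i, (B j).card := Finset.card_biUnion_le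
        _ ≤ ∑ j ∈ Finset.range i, (2 * k + 6) :=
            Finset.sum_le_sum (fun j hj => (hB j (Finset.mem_range.1 hj)).2.1)
        _ = i * (2 * k + 6) := by simp
        _ ≤ t * (2 * k + 6) := Nat.mul_le_mul_right _ (by omega)
        _ ≤ u := htu
    have hUmem : ∀ v, v ∉ U ↔ ∀ j < i, v ∉ B j := by
      intro v; simp [U]
    have hWc : (Uᶜ).card + U.card = n := by rw [← hn]; exact Finset.card_compl_add_card U
    have hq : ∀ v, ((Uᶜ).filter (fun w => ¬ G.Adj v w)).card ≤ n - δ := by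
      intro v
      have e1 := Finset.card_filter_add_card_filter_not (s := (Finset.univ : Finset V)) (G.Adj v)
      rw [Finset.card_univ, hn] at e1
      have e2 : ((Uᶜ).filter (fun w => ¬ G.Adj v w)).card ≤
          (Finset.univ.filter (fun w => ¬ G.Adj v w)).card :=
        Finset.card_le_card (Finset.filter_subset_filter _ (Finset.subset_univ _))
      have := hδ v
      omega
    obtain ⟨f, hfW, hfd, hfA⟩ := prob G Uᶜ k a (n - δ) t (Uᶜ).card rfl hq
      (h1 _ (by omega) (by omega)) (h2 _ (by omega)) i (by omega) A (fun j hj => (hB j hj).2.2.2)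
    obtain ⟨B', hBB', hB'U, hB'c, hB'conn⟩ := connect G n δ u k hn hδ h3 U hUc (hconn U hUc)
      (Finset.univ.image f) ⟨f ⟨0, hk⟩, by simp⟩
      (by simpa using Finset.card_image_le (s := (Finset.univ : Finset (Fin k))) (f := f)) (by
        intro b hb
        simp only [Finset.mem_image, Finset.mem_univ, true_and] at hb
        obtain ⟨l, rfl⟩ := hb
        simpa using hfW l)
    have hfB : ∀ l, f l ∈ B' := fun l => hBB' (by simp)
    let A' := (Uᶜ).filter (fun v => ∀ l, ¬ G.Adj v (f l))
    refine ⟨fun j => if j = i then B' else B j, fun j => if j = i then A' else A j, ?_, ?_, ?_⟩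
    · intro j hj
      by_cases hji : j = i
      · subst hji
        beta_reduce
        rw [if_pos rfl, if_pos rfl]
        exact ⟨⟨_, hfB ⟨0, hk⟩⟩, hB'c, hB'conn, hfd⟩
      · beta_reduce
        rw [if_neg hji, if_neg hji]
        exact hB j (by omega)
    · intro j hj j' hj'
      have hji' : j' ≠ i := by omega
      by_cases hji : j = i
      · subst hji
        simp only [if_true, hji', if_false]
        refine ⟨?_, ?_⟩
        · rw [Finset.disjoint_left]
          intro x hx hx'
          exact (hUmem x).1 (hB'U x hx') j' hj' hx
        · obtain ⟨l, hl⟩ := hfA j' hj'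
          obtain ⟨x, hx, hxv⟩ := hdom (f l) ((hUmem _).1 (hB'U _ (hfB l))) j' hj' hl
          exact ⟨x, hx, f l, hfB l, hxv⟩
      · simp only [hji, hji', if_false]
        exact hBB j (by omega) j' hj'
    · intro v hv j hj hvA
      have hvU : v ∉ U := by
        rw [hUmem]
        intro j hj
        have := hv j (by omega)
        beta_reduce at this
        rwa [if_neg (by omega)] at this
      by_cases hji : j = i
      · subst hji
        simp only [if_true] at hvA ⊢
        have : ¬ ∀ l, ¬ G.Adj v (f l) := by
          intro hh
          exact hvA (by simp only [A', Finset.mem_filter, Finset.mem_compl]; exact ⟨hvU, hh⟩)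
        push Not at this
        obtain ⟨l, hl⟩ := this
        exact ⟨f l, hfB l, hl.symm⟩
      · simp only [hji, if_false] at hvA ⊢
        exact hdom v ((hUmem v).1 hvU) j (by omega) hvA

open Classical in
theorem core {V : Type} [Fintype V] (G : SimpleGraph V) (n δ u k t : ℕ)
    (hn : Fintype.card V = n) (hδ : ∀ v, δ ≤ (Finset.univ.filter (G.Adj v)).card)
    (h3 : 2 * u + n < 3 * δ)
    (hconn : ∀ U : Finset V, U.card ≤ u → (G.induce {v | v ∉ U}).Connected)
    (hk : 1 ≤ k) (htu : t * (2 * k + 6) ≤ u)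
    (h17 : 17 * (n - δ) + 10 * u ≤ 10 * n) (h2u : 2 * u < n)
    (hnum : 2 * (t : ℝ) * (4 * (10 / 17 : ℝ) ^ k) ^ k < 1) : G.HasCompleteMinor t := by
  have hfl := Nat.floor_le (a := 2 * (n : ℝ) * (10 / 17 : ℝ) ^ k) (by positivity)
  have hfl2 := Nat.lt_floor_add_one (2 * (n : ℝ) * (10 / 17 : ℝ) ^ k)
  set a := ⌊2 * (n : ℝ) * (10 / 17 : ℝ) ^ k⌋₊ with ha
  obtain ⟨B, A, hB, hBB, -⟩ := greedy G n δ u k t a hn hδ h3 hconn hk htu (by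
    intro m hm hmn
    have hq : ((n - δ : ℕ) : ℝ) ≤ 10 / 17 * m := by
      have : 17 * (n - δ) ≤ 10 * m := by omega
      have : (17 : ℝ) * ((n - δ : ℕ) : ℝ) ≤ 10 * m := by exact_mod_cast this
      linarith
    have hmn' : (m : ℝ) ≤ n := by exact_mod_cast hmn
    have : 2 * ((m : ℝ) * ((n - δ : ℕ) : ℝ) ^ k) ≤ ((a : ℝ) + 1) * (m : ℝ) ^ k := by
      calc 2 * ((m : ℝ) * ((n - δ : ℕ) : ℝ) ^ k) ≤ 2 * ((n : ℝ) * (10 / 17 * m) ^ k) := by gcongr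
        _ = (2 * (n : ℝ) * (10 / 17 : ℝ) ^ k) * (m : ℝ) ^ k := by rw [mul_pow]; ring
        _ ≤ _ := by gcongr
    exact_mod_cast this) (by
    intro m hm
    have hmn' : (n : ℝ) ≤ 2 * m := by
      have : n ≤ 2 * m := by omega
      exact_mod_cast this
    have hm0 : (0 : ℝ) < m := by
      have : 0 < m := by omega
      exact_mod_cast this
    have : 2 * ((t : ℝ) * (a : ℝ) ^ k) < (m : ℝ) ^ k := by
      calc 2 * ((t : ℝ) * (a : ℝ) ^ k) ≤ 2 * ((t : ℝ) * (2 * (2 * m) * (10 / 17 : ℝ) ^ k) ^ k) := by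
            gcongr
            exact hfl.trans (by gcongr)
        _ = (2 * (t : ℝ) * (4 * (10 / 17 : ℝ) ^ k) ^ k) * (m : ℝ) ^ k := by
            rw [show 2 * (2 * (m : ℝ)) * (10 / 17 : ℝ) ^ k = (4 * (10 / 17 : ℝ) ^ k) * m by ring, mul_pow _ (m : ℝ)]
            ring
        _ < 1 * (m : ℝ) ^ k := by gcongr
        _ = _ := one_mul _
    exact_mod_cast this) t le_rfl
  refine ⟨fun i => (B i : Set V), ?_, ?_, ?_, ?_⟩
  · intro i
    exact_mod_cast (hB i i.2).1
  · intro i j hij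
    rw [Finset.disjoint_coe]
    rcases lt_or_gt_of_ne (Fin.val_ne_of_ne hij) with h | h
    · exact (hBB j j.2 i h).1
    · exact (hBB i i.2 j h).1.symm
  · intro i
    exact (hB i i.2).2.2.1
  · intro i j hij
    rcases lt_or_gt_of_ne (Fin.val_ne_of_ne hij) with h | h
    · exact (hBB j j.2 i h).2
    · obtain ⟨x, hx, y, hy, hxy⟩ := (hBB i i.2 j h).2
      exact ⟨y, hy, x, hx, hxy.symm⟩

end KT

namespace KT

open Classical in
theorem conn_of_common {V : Type} [Fintype V] (G : SimpleGraph V) (n δ u : ℕ)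
    (hn : Fintype.card V = n) (hδ : ∀ v, δ ≤ (Finset.univ.filter (G.Adj v)).card)
    (h3 : u + n < 2 * δ) (hun : u < n) (U : Finset V) (hU : U.card ≤ u) :
    (G.induce {v | v ∉ U}).Connected := by
  have key : ∀ v, δ ≤ (Finset.univ.filter (G.Adj v) \ U).card + U.card := fun v => by
    have := Finset.card_le_card_sdiff_add_card (s := Finset.univ.filter (G.Adj v)) (t := U)
    exact (hδ v).trans this
  refine conn_of_cut _ _ ?_ ?_
  · by_contra hne
    rw [Set.not_nonempty_iff_eq_empty] at hne
    have : U = Finset.univ := by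
      ext v
      have : v ∉ {v | v ∉ U} := by rw [hne]; simp
      simpa using this
    rw [this, Finset.card_univ] at hU
    omega
  · rintro X hX ⟨x, hx⟩ ⟨y, hy, hyX⟩
    have : ∃ c, c ∉ U ∧ G.Adj x c ∧ G.Adj y c := by
      by_contra hcon
      push Not at hcon
      have kx := key x
      have ky := key y
      have d1 : Disjoint (Finset.univ.filter (G.Adj x) \ U) (Finset.univ.filter (G.Adj y) \ U) := by
        rw [Finset.disjoint_left]
        intro c hc hc'
        simp only [Finset.mem_sdiff, Finset.mem_filter, Finset.mem_univ, true_and] at hc hc'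
        exact hcon c hc.2 hc.1 hc'.1
      have d3 : Disjoint (Finset.univ.filter (G.Adj x) \ U ∪ Finset.univ.filter (G.Adj y) \ U) U := by
        rw [Finset.disjoint_left]
        intro c hc hc'
        simp only [Finset.mem_union, Finset.mem_sdiff] at hc
        tauto
      have := Finset.card_le_univ ((Finset.univ.filter (G.Adj x) \ U ∪ Finset.univ.filter (G.Adj y) \ U) ∪ U)
      rw [Finset.card_union_of_disjoint d3, Finset.card_union_of_disjoint d1] at this
      omega
    obtain ⟨c, hcU, hxc, hyc⟩ := this
    by_cases hc : c ∈ X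
    · exact ⟨c, hc, y, ⟨hy, hyX⟩, hyc.symm⟩
    · exact ⟨x, hx, c, ⟨hcU, hc⟩, hxc⟩

open Classical in
theorem dense_part {V : Type} [Fintype V] (G : SimpleGraph V) (d u k t : ℕ) (hd : 1 ≤ d)
    (hδ : ∀ v, d ≤ (Finset.univ.filter (G.Adj v)).card)
    (hu : 10 * u ≤ 3 * d) (hk : 1 ≤ k) (htu : t * (2 * k + 6) ≤ u)
    (hnum : 2 * (t : ℝ) * (4 * (10 / 17 : ℝ) ^ k) ^ k < 1)
    (U Z : Finset V) (hU : U.card ≤ u) (hZ : Z.card ≤ d) (hZne : Z.Nonempty)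
    (hcl : ∀ a ∈ Z, ∀ b, G.Adj a b → b ∈ Z ∨ b ∈ U) : G.HasCompleteMinor t := by
  have hcard : Fintype.card {x // x ∈ Z} = Z.card := Fintype.card_coe Z
  have hdeg : ∀ v : {x // x ∈ Z}, d - U.card ≤
      (Finset.univ.filter ((G.comap (Subtype.val : {x // x ∈ Z} → V)).Adj v)).card := by
    intro v
    have hsub : Finset.univ.filter (G.Adj v.1) ⊆
      (Finset.univ.filter ((G.comap (Subtype.val : {x // x ∈ Z} → V)).Adj v)).image Subtype.val ∪ U := by
      intro b hb
      simp only [Finset.mem_filter, Finset.mem_univ, true_and] at hb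
      rw [Finset.mem_union, Finset.mem_image]
      rcases hcl v.1 v.2 b hb with h | h
      · exact Or.inl ⟨⟨b, h⟩, by simpa using hb, rfl⟩
      · exact Or.inr h
    have h1 := Finset.card_le_card hsub
    have h2 := Finset.card_union_le ((Finset.univ.filter ((G.comap (Subtype.val : {x // x ∈ Z} → V)).Adj v)).image Subtype.val) U
    have h3 : ((Finset.univ.filter ((G.comap (Subtype.val : {x // x ∈ Z} → V)).Adj v)).image Subtype.val).card ≤ _ := Finset.card_image_le
    have := hδ v.1
    omega
  have hZl : d - U.card < Z.card := by
    obtain ⟨z, hz⟩ := hZne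
    refine (hdeg ⟨z, hz⟩).trans_lt ?_
    rw [← hcard, ← Finset.card_univ]
    apply Finset.card_lt_card
    rw [Finset.filter_ssubset]
    exact ⟨⟨z, hz⟩, by simp, by simp⟩
  refine lift_emb G (G.comap (Subtype.val : {x // x ∈ Z} → V)) Subtype.val Subtype.val_injective
    (fun a b h => h) t ?_
  refine core _ Z.card (d - U.card) u k t hcard hdeg (by omega) ?_ hk htu (by omega) (by omega) hnum
  intro U' hU'
  exact conn_of_common _ Z.card (d - U.card) u hcard hdeg (by omega) (by omega) U' hU'

open Classical in
theorem dense {V : Type} [Fintype V] (G : SimpleGraph V) (d u k t : ℕ) (hd : 1 ≤ d)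
    (hne : Nonempty V)
    (hn : Fintype.card V ≤ 2 * d) (hδ : ∀ v, d ≤ (Finset.univ.filter (G.Adj v)).card)
    (hu : 10 * u ≤ 3 * d) (hk : 1 ≤ k) (htu : t * (2 * k + 6) ≤ u)
    (hnum : 2 * (t : ℝ) * (4 * (10 / 17 : ℝ) ^ k) ^ k < 1) : G.HasCompleteMinor t := by
  have hnl : d < Fintype.card V := by
    obtain ⟨z⟩ := hne
    refine (hδ z).trans_lt ?_
    rw [← Finset.card_univ]
    apply Finset.card_lt_card
    rw [Finset.filter_ssubset]
    exact ⟨z, by simp, by simp⟩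
  by_cases hconn : ∀ U : Finset V, U.card ≤ u → (G.induce {v | v ∉ U}).Connected
  · exact core G (Fintype.card V) d u k t rfl hδ (by omega) hconn hk htu (by omega) (by omega) hnum
  · push Not at hconn
    obtain ⟨U, hU, hUc⟩ := hconn
    have hcut : ∃ X : Set V, X ⊆ {v | v ∉ U} ∧ X.Nonempty ∧ ({v | v ∉ U} \ X).Nonempty ∧
        ∀ a ∈ X, ∀ b ∈ {v | v ∉ U} \ X, ¬ G.Adj a b := by
      by_contra hcon
      push Not at hcon
      apply hUc
      refine conn_of_cut _ _ ?_ hcon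
      by_contra hne
      rw [Set.not_nonempty_iff_eq_empty] at hne
      have : U = Finset.univ := by
        ext v
        have : v ∉ {v | v ∉ U} := by rw [hne]; simp
        simpa using this
      rw [this, Finset.card_univ] at hU
      omega
    obtain ⟨X, hXU, hX, hY, hXY⟩ := hcut
    let X' : Finset V := Finset.univ.filter (· ∈ X)
    let Y' : Finset V := Finset.univ.filter (fun v => v ∉ U ∧ v ∉ X)
    have hdis : Disjoint X' Y' := by
      rw [Finset.disjoint_left]
      intro c h1 h2
      simp [X', Y'] at h1 h2
      exact h2.2 h1
    have hc := Finset.card_le_univ (X' ∪ Y')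
    rw [Finset.card_union_of_disjoint hdis] at hc
    have hor : X'.card ≤ d ∨ Y'.card ≤ d := by omega
    rcases hor with h | h
    · refine dense_part G d u k t hd hδ hu hk htu hnum U X' hU h ?_ ?_
      · obtain ⟨x, hx⟩ := hX
        exact ⟨x, by simpa [X'] using hx⟩
      · intro a ha b hab
        simp only [X', Finset.mem_filter, Finset.mem_univ, true_and] at ha ⊢
        by_contra hcon
        push Not at hcon
        exact hXY a ha b ⟨hcon.2, hcon.1⟩ hab
    · refine dense_part G d u k t hd hδ hu hk htu hnum U Y' hU h ?_ ?_
      · obtain ⟨x, hx, hx'⟩ := hY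
        exact ⟨x, by simp only [Y', Finset.mem_filter, Finset.mem_univ, true_and]; exact ⟨hx, hx'⟩⟩
      · intro a ha b hab
        simp only [Y', Finset.mem_filter, Finset.mem_univ, true_and] at ha ⊢
        by_contra hcon
        push Not at hcon
        exact hXY b (hcon.1 hcon.2) a ha hab.symm

end KT

namespace KT

/-- contraction of `v` into `u` -/
def contr {V : Type} (G : SimpleGraph V) (u v : V) : SimpleGraph {w : V // w ≠ v} where
  Adj a b := a ≠ b ∧ (G.Adj a b ∨ (a.1 = u ∧ G.Adj v b) ∨ (b.1 = u ∧ G.Adj v a))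
  symm := ⟨by
    rintro a b ⟨h, h1 | h1 | h1⟩
    · exact ⟨h.symm, Or.inl h1.symm⟩
    · exact ⟨h.symm, Or.inr (Or.inr h1)⟩
    · exact ⟨h.symm, Or.inr (Or.inl h1)⟩⟩
  loopless := ⟨fun a h => h.1 rfl⟩

theorem contr_lift {V : Type} (G : SimpleGraph V) (u v : V) (huv : G.Adj u v) (t : ℕ)
    (h : (contr G u v).HasCompleteMinor t) : G.HasCompleteMinor t := by
  refine lift G (contr G u v) (fun a => {w | w = a.1 ∨ (a.1 = u ∧ w = v)}) ?_ ?_ ?_ t h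
  · intro a b hab
    rw [Set.disjoint_left]
    rintro w (rfl | ⟨h1, rfl⟩) (h2 | ⟨h2, h3⟩)
    · exact hab (Subtype.ext h2)
    · exact a.2 h3
    · exact b.2 h2.symm
    · exact hab (Subtype.ext (h1.trans h2.symm))
  · intro a
    by_cases ha : a.1 = u
    · have : {w | w = a.1 ∨ (a.1 = u ∧ w = v)} = insert v {u} := by
        ext w; simp [ha, or_comm]
      rw [this]
      exact conn_insert G _ (conn_singleton G u) u v rfl huv
    · have : {w | w = a.1 ∨ (a.1 = u ∧ w = v)} = {a.1} := by
        ext w; simp [ha]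
      rw [this]
      exact conn_singleton G _
  · rintro a b ⟨-, h1 | ⟨h1, h2⟩ | ⟨h1, h2⟩⟩
    · exact ⟨a, Or.inl rfl, b, Or.inl rfl, h1⟩
    · exact ⟨v, Or.inr ⟨h1, rfl⟩, b, Or.inl rfl, h2⟩
    · exact ⟨a, Or.inl rfl, v, Or.inr ⟨h1, rfl⟩, h2.symm⟩

theorem ncard_edges {V : Type} (G : SimpleGraph V) [Fintype G.edgeSet] :
    G.edgeSet.ncard = G.edgeFinset.card := by
  rw [← SimpleGraph.coe_edgeFinset, Set.ncard_coe_finset]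

open Classical in
theorem contr_edges {V : Type} [Fintype V] (G : SimpleGraph V) (u v : V) (huv : G.Adj u v) :
    G.edgeSet.ncard ≤ (contr G u v).edgeSet.ncard + 1 +
      (Finset.univ.filter (fun w => G.Adj v w ∧ G.Adj u w)).card := by
  rw [ncard_edges, ncard_edges]
  let E' : Finset (Sym2 V) := (contr G u v).edgeFinset.image (Sym2.map Subtype.val)
  have hE' : E'.card ≤ (contr G u v).edgeFinset.card := Finset.card_image_le
  let N : Finset V := Finset.univ.filter (fun w => G.Adj v w ∧ ¬ G.Adj u w ∧ w ≠ u)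
  let M : Finset (Sym2 V) := N.image (fun w => s(u, w))
  have hM : M.card = N.card := by
    apply Finset.card_image_of_injective
    intro a b hab
    have hab' : s(u, a) = s(u, b) := hab
    rw [Sym2.eq_iff] at hab'
    rcases hab' with h | h
    · exact h.2
    · exact h.2.trans h.1
  have hu : u ≠ v := huv.ne
  have h1 : G.edgeFinset \ G.incidenceFinset v ⊆ E' := by
    intro e he
    induction e using Sym2.ind with
    | _ a b =>
      simp only [Finset.mem_sdiff, SimpleGraph.mem_edgeFinset, SimpleGraph.mem_edgeSet,
        SimpleGraph.mem_incidenceFinset, SimpleGraph.mk'_mem_incidenceSet_iff, not_and, not_or] at he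
      obtain ⟨hab, hv⟩ := he
      have hv := hv hab
      refine Finset.mem_image.2 ⟨s(⟨a, fun h => hv.1 h.symm⟩, ⟨b, fun h => hv.2 h.symm⟩), ?_, rfl⟩
      rw [SimpleGraph.mem_edgeFinset, SimpleGraph.mem_edgeSet]
      exact ⟨fun h => hab.ne (congrArg Subtype.val h), Or.inl hab⟩
  have h2 : M ⊆ E' := by
    intro e he
    obtain ⟨w, hw, rfl⟩ := Finset.mem_image.1 he
    simp only [N, Finset.mem_filter, Finset.mem_univ, true_and] at hw
    refine Finset.mem_image.2 ⟨s(⟨u, hu⟩, ⟨w, hw.1.ne'⟩), ?_, rfl⟩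
    rw [SimpleGraph.mem_edgeFinset, SimpleGraph.mem_edgeSet]
    exact ⟨fun h => hw.2.2 (congrArg Subtype.val h).symm, Or.inr (Or.inl ⟨rfl, hw.1⟩)⟩
  have h3 : Disjoint (G.edgeFinset \ G.incidenceFinset v) M := by
    rw [Finset.disjoint_left]
    intro e he he'
    obtain ⟨w, hw, rfl⟩ := Finset.mem_image.1 he'
    simp only [N, Finset.mem_filter, Finset.mem_univ, true_and] at hw
    simp only [Finset.mem_sdiff, SimpleGraph.mem_edgeFinset, SimpleGraph.mem_edgeSet] at he
    exact hw.2.1 he.1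
  have h4 := Finset.card_le_card (Finset.union_subset h1 h2)
  rw [Finset.card_union_of_disjoint h3, hM] at h4
  have h5 := Finset.card_le_card_sdiff_add_card (s := G.edgeFinset) (t := G.incidenceFinset v)
  rw [SimpleGraph.card_incidenceFinset_eq_degree] at h5
  have h6 : G.neighborFinset v ⊆ N ∪ Finset.univ.filter (fun w => G.Adj v w ∧ G.Adj u w) ∪ {u} := by
    intro w hw
    simp only [SimpleGraph.mem_neighborFinset] at hw
    simp only [N, Finset.mem_union, Finset.mem_filter, Finset.mem_univ, true_and, Finset.mem_singleton]
    tauto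
  have h7 := Finset.card_le_card h6
  rw [SimpleGraph.card_neighborFinset_eq_degree] at h7
  have h8 := Finset.card_union_le (N ∪ Finset.univ.filter (fun w => G.Adj v w ∧ G.Adj u w)) {u}
  have h9 := Finset.card_union_le N (Finset.univ.filter (fun w => G.Adj v w ∧ G.Adj u w))
  rw [Finset.card_singleton] at h8
  omega

open Classical in
theorem del_edges {V : Type} [Fintype V] (G : SimpleGraph V) (v : V) (hv : ∀ w, ¬ G.Adj v w) :
    G.edgeSet.ncard ≤ (G.comap (Subtype.val : {w : V // w ≠ v} → V)).edgeSet.ncard := by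
  rw [ncard_edges, ncard_edges]
  let E' : Finset (Sym2 V) :=
    (G.comap (Subtype.val : {w : V // w ≠ v} → V)).edgeFinset.image (Sym2.map Subtype.val)
  have hE' : E'.card ≤ _ := Finset.card_image_le
  refine le_trans (Finset.card_le_card ?_) hE'
  intro e he
  induction e using Sym2.ind with
  | _ a b =>
    rw [SimpleGraph.mem_edgeFinset, SimpleGraph.mem_edgeSet] at he
    refine Finset.mem_image.2 ⟨s(⟨a, ?_⟩, ⟨b, ?_⟩), ?_, rfl⟩
    · rintro rfl; exact hv _ he
    · rintro rfl; exact hv _ he.symm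
    · rw [SimpleGraph.mem_edgeFinset, SimpleGraph.mem_edgeSet]
      exact he

open Classical in
theorem mader (d t : ℕ) (hd : 1 ≤ d)
    (hdense : ∀ (V : Type) [Fintype V] (G : SimpleGraph V), Nonempty V → Fintype.card V ≤ 2 * d →
      (∀ v, d ≤ (Finset.univ.filter (G.Adj v)).card) → G.HasCompleteMinor t) (N : ℕ) :
    ∀ (M : ℕ) (V : Type) [Fintype V] (G : SimpleGraph V), Fintype.card V ≤ N →
      G.edgeSet.ncard ≤ M →
      0 < G.edgeSet.ncard → d * Fintype.card V ≤ G.edgeSet.ncard → G.HasCompleteMinor t := by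
  induction N with
  | zero =>
    intro M V _ G hN hM hpos hE
    exfalso
    obtain ⟨e0, he0⟩ := (Set.ncard_pos).1 hpos
    have h3 : 0 < Fintype.card V := by
      induction e0 using Sym2.ind with
      | _ a b => exact Fintype.card_pos_iff.2 ⟨a⟩
    omega
  | succ N ihN =>
  intro M
  induction M with
  | zero =>
    intro V _ G hN hM hpos hE
    omega
  | succ M ihM =>
    intro V _ G hN hM hpos hE
    obtain ⟨e0, he0⟩ := (Set.ncard_pos).1 hpos
    have hcard : ∀ v : V, Fintype.card {w : V // w ≠ v} + 1 = Fintype.card V := by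
      intro v
      have h1 : Fintype.card {w : V // w ≠ v} = Fintype.card V - 1 := by
        simp [Fintype.card_subtype_compl]
      have : 0 < Fintype.card V := Fintype.card_pos_iff.2 ⟨v⟩
      omega
    by_cases hiso : ∃ v, ∀ w, ¬ G.Adj v w
    · obtain ⟨v, hv⟩ := hiso
      have h1 := del_edges G v hv
      have h2 := hcard v
      refine lift_emb G (G.comap (Subtype.val : {w : V // w ≠ v} → V)) Subtype.val
        Subtype.val_injective (fun a b h => h) t (ihN _ _ _ (by omega) le_rfl (by omega) ?_)
      refine le_trans ?_ h1
      refine le_trans (Nat.mul_le_mul_left d ?_) hE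
      omega
    · push Not at hiso
      by_cases hbig : d * Fintype.card V < G.edgeSet.ncard
      · have h2 : (G.deleteEdges {e0}).edgeSet.ncard = G.edgeSet.ncard - 1 := by
          rw [SimpleGraph.edgeSet_deleteEdges, Set.ncard_sdiff_singleton_of_mem he0]
        have h3 : 0 < Fintype.card V := by
          induction e0 using Sym2.ind with
          | _ a b => exact Fintype.card_pos_iff.2 ⟨a⟩
        have h4 : 0 < d * Fintype.card V := Nat.mul_pos hd h3
        refine lift_emb G (G.deleteEdges {e0}) id Function.injective_id
          (fun a b h => (SimpleGraph.deleteEdges_le {e0}) h) t (ihM _ _ hN (by omega) (by omega) (by omega))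
      · by_cases hcon : ∃ u v, G.Adj u v ∧
            (Finset.univ.filter (fun w => G.Adj v w ∧ G.Adj u w)).card + 1 ≤ d
        · obtain ⟨u, v, huv, hc⟩ := hcon
          have h1 := contr_edges G u v huv
          have h2 := hcard v
          have h3 : 0 < Fintype.card {w : V // w ≠ v} := Fintype.card_pos_iff.2 ⟨⟨u, huv.ne⟩⟩
          have h4 : 0 < d * Fintype.card {w : V // w ≠ v} := Nat.mul_pos hd h3
          have h5 : d * Fintype.card {w : V // w ≠ v} ≤ (contr G u v).edgeSet.ncard := by
            have : d * Fintype.card V = d * Fintype.card {w : V // w ≠ v} + d := by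
              rw [← h2]; ring
            omega
          exact contr_lift G u v huv t (ihN _ _ _ (by omega) le_rfl (by omega) h5)
        · push Not at hcon
          have hex : ∃ v, G.degree v ≤ 2 * d := by
            by_contra hno
            push Not at hno
            have hs := G.sum_degrees_eq_twice_card_edges
            rw [← ncard_edges] at hs
            have h3 : 0 < Fintype.card V := by
              induction e0 using Sym2.ind with
              | _ a b => exact Fintype.card_pos_iff.2 ⟨a⟩
            have : ∑ v : V, (2 * d + 1) ≤ ∑ v, G.degree v := Finset.sum_le_sum (fun v _ => hno v)
            rw [hs, Finset.sum_const, Finset.card_univ, smul_eq_mul] at this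
            nlinarith
          obtain ⟨v, hv⟩ := hex
          obtain ⟨w, hw⟩ := hiso v
          refine lift_emb G (G.comap (Subtype.val : {w : V // G.Adj v w} → V)) Subtype.val
            Subtype.val_injective (fun a b h => h) t (hdense _ _ ⟨w, hw⟩ ?_ ?_)
          · rw [← SimpleGraph.card_neighborFinset_eq_degree] at hv
            rw [Fintype.card_subtype]
            convert hv using 2
            ext; simp
          · intro x
            have := hcon x.1 v x.2.symm
            refine (Nat.lt_succ_iff.1 this).trans ?_
            have hsub : (Finset.univ.filter (fun w => G.Adj v w ∧ G.Adj x w)) ⊆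
              (Finset.univ.filter ((G.comap (Subtype.val : {w : V // G.Adj v w} → V)).Adj x)).image Subtype.val := by
              intro b hb
              simp only [Finset.mem_filter, Finset.mem_univ, true_and] at hb
              exact Finset.mem_image.2 ⟨⟨b, hb.1⟩, by simpa using hb.2, rfl⟩
            exact (Finset.card_le_card hsub).trans Finset.card_image_le

end KT

namespace KT

theorem numerics (d : ℕ) (L : ℝ) (hL : L = Real.sqrt (Real.log d)) (hL2 : 2000 ≤ L)
    (t k : ℕ) (ht : t = ⌈(d : ℝ) / (10 * L)⌉₊) (hk : k = ⌈29 / 20 * L⌉₊) :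
    1 ≤ d ∧ 1 ≤ k ∧ 10 * (t * (2 * k + 6)) ≤ 3 * d ∧
      2 * (t : ℝ) * (4 * (10 / 17 : ℝ) ^ k) ^ k < 1 := by
  have hL0 : 0 < L := by linarith
  have hlog : Real.log d = L ^ 2 := by
    have h0 : 0 < Real.log d := Real.sqrt_pos.1 (hL ▸ hL0)
    rw [hL, Real.sq_sqrt h0.le]
  have hd : 1 ≤ d := by
    rcases Nat.eq_zero_or_pos d with h | h
    · subst h
      simp at hlog
      nlinarith
    · exact h
  have hd0 : (0 : ℝ) < d := by exact_mod_cast hd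
  have hdexp : (d : ℝ) = Real.exp (L ^ 2) := by rw [← hlog, Real.exp_log hd0]
  have hdL : L ^ 2 ≤ d := by
    rw [hdexp]; linarith [Real.add_one_le_exp (L ^ 2)]
  have hk1 : 29 / 20 * L ≤ k := by rw [hk]; exact Nat.le_ceil _
  have hk2 : (k : ℝ) < 29 / 20 * L + 1 := by rw [hk]; exact Nat.ceil_lt_add_one (by positivity)
  have ht2 : (t : ℝ) < d / (10 * L) + 1 := by rw [ht]; exact Nat.ceil_lt_add_one (by positivity)
  have hkpos : 1 ≤ k := by
    have : (1 : ℝ) ≤ k := by linarith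
    exact_mod_cast this
  set x := (d : ℝ) / (10 * L) with hx
  have hxL : x * L = d / 10 := by rw [hx]; field_simp
  have hx0 : 0 ≤ x := by positivity
  have hxs : x ≤ d / 20000 := by nlinarith
  refine ⟨hd, hkpos, ?_, ?_⟩
  · have : 10 * ((t : ℝ) * (2 * k + 6)) ≤ 3 * d := by
      have h1 : (t : ℝ) * (2 * k + 6) ≤ (x + 1) * (29 / 10 * L + 8) := by
        apply mul_le_mul ht2.le (by linarith) (by positivity) (by positivity)
      have h2 : (x + 1) * (29 / 10 * L + 8) = 29 / 10 * (x * L) + 8 * x + 29 / 10 * L + 8 := by ring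
      have h3 : 2000 * L ≤ d := by nlinarith
      rw [h2, hxL] at h1
      linarith
    exact_mod_cast this
  · have hb : (10 / 17 : ℝ) ≤ Real.exp (-(1 / 2)) := by
      rw [Real.exp_neg, le_inv_comm₀ (by norm_num) (Real.exp_pos _)]
      have h1 : Real.exp (1 / 2) ^ 2 = Real.exp 1 := by
        rw [← Real.exp_nat_mul]; norm_num
      have h2 := Real.exp_one_lt_d9
      have h3 := Real.exp_pos (1 / 2)
      nlinarith
    have h4 : (4 : ℝ) ≤ Real.exp 2 := by
      have h1 : Real.exp 1 ^ 2 = Real.exp 2 := by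
        rw [← Real.exp_nat_mul]; norm_num
      have h2 := Real.exp_one_gt_d9
      nlinarith
    have h2t : 2 * (t : ℝ) ≤ Real.exp (L ^ 2) := by
      rw [← hdexp]
      nlinarith
    have hin : 4 * (10 / 17 : ℝ) ^ k ≤ Real.exp (2 - k / 2) := by
      calc 4 * (10 / 17 : ℝ) ^ k ≤ Real.exp 2 * Real.exp (-(1 / 2)) ^ k := by gcongr
        _ = Real.exp (2 - k / 2) := by
          rw [← Real.exp_nat_mul, ← Real.exp_add]
          congr 1; ring
    calc 2 * (t : ℝ) * (4 * (10 / 17 : ℝ) ^ k) ^ k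
        ≤ Real.exp (L ^ 2) * Real.exp (2 - k / 2) ^ k := by gcongr
      _ = Real.exp (L ^ 2 + k * (2 - k / 2)) := by
          rw [← Real.exp_nat_mul, ← Real.exp_add]
      _ < 1 := by
          rw [Real.exp_lt_one_iff]
          have h5 : (29 / 20 * L) * (29 / 20 * L / 2 - 2) ≤ (k : ℝ) * (k / 2 - 2) := by
            apply mul_le_mul hk1 (by linarith) (by linarith) (by positivity)
          nlinarith

end KT

/-- Every graph with `|E|/|V| ≥ d`, for `d` a sufficiently large integer, contains a
complete minor on at least `d / (10 √(ln d))` vertices. -/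
theorem complete_minor_of_average_degree :
    ∃ d₀ : ℕ, ∀ d : ℕ, d₀ ≤ d →
      ∀ (V : Type) [Fintype V] (G : SimpleGraph V),
        (d : ℝ) ≤ (G.edgeSet.ncard : ℝ) / (Fintype.card V : ℝ) →
        G.HasCompleteMinor ⌈(d : ℝ) / (10 * Real.sqrt (Real.log d))⌉₊ := by
  refine ⟨⌈Real.exp (2000 ^ 2)⌉₊ + 1, ?_⟩
  intro d hd V _ G hG
  have hdR : Real.exp (2000 ^ 2) ≤ (d : ℝ) :=
    (Nat.le_ceil _).trans (by exact_mod_cast (by omega : ⌈Real.exp (2000 ^ 2)⌉₊ ≤ d))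
  have hL : 2000 ≤ Real.sqrt (Real.log d) := by
    apply Real.le_sqrt_of_sq_le
    rw [Real.le_log_iff_exp_le ((Real.exp_pos _).trans_le hdR)]
    exact hdR
  obtain ⟨h1, h2, h3, h4⟩ := KT.numerics d _ rfl hL _ _ rfl rfl
  have hd0 : (0 : ℝ) < d := by exact_mod_cast h1
  have hV : (0 : ℝ) < (Fintype.card V : ℝ) := by
    rcases (Nat.cast_nonneg (α := ℝ) (Fintype.card V)).lt_or_eq with h | h
    · exact h
    · rw [← h, div_zero] at hG
      linarith
  rw [le_div_iff₀ hV] at hG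
  have hG' : d * Fintype.card V ≤ G.edgeSet.ncard := by exact_mod_cast hG
  have hpos : 0 < G.edgeSet.ncard := by
    have : (0 : ℝ) < (G.edgeSet.ncard : ℝ) := (mul_pos hd0 hV).trans_le hG
    exact_mod_cast this
  classical
  refine KT.mader d _ h1 ?_ _ _ V G le_rfl le_rfl hpos hG'
  intro V' _ G' hne hcard hdeg
  refine KT.dense G' d _ _ _ h1 hne hcard ?_ h3 h2 le_rfl h4
  intro v
  convert hdeg v
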